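/- Let T be a tree with at least one vertex of degree at least 3 (equivalently T is connected, acyclic, and not a path) and with n(T) ≥ 4. Then dim_nl(T) = β'(T) − 1 if and only if T is obtained from a star K_{1,n} (n ≥ 3) by subdividing all but one of its edges at most once each. -/

import Mathlib

/-- `X` is a nonlocal resolving set of `G`: every pair of distinct non-adjacent
vertices is resolved by some vertex of `X`. -/
def IsNLResolving {V : Type*} (G : SimpleGraph V) (X : Finset V) : Prop :=
  ∀ u v : V, u ≠ v → ¬ G.Adj u v → ∃ x ∈ X, G.dist u x ≠ G.dist v x

/-- The nonlocal metric dimension of `G`. -/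
noncomputable def nldim {V : Type*} [Fintype V] (G : SimpleGraph V) : ℕ :=
  sInf {n | ∃ X : Finset V, X.card = n ∧ IsNLResolving G X}

/-- `X` is a resolving set of `G`. -/
def IsResolving {V : Type*} (G : SimpleGraph V) (X : Finset V) : Prop :=
  ∀ u v : V, u ≠ v → ∃ x ∈ X, G.dist u x ≠ G.dist v x

/-- The metric dimension of `G`. -/
noncomputable def metricDim {V : Type*} [Fintype V] (G : SimpleGraph V) : ℕ :=
  sInf {n | ∃ X : Finset V, X.card = n ∧ IsResolving G X}

/-- The corona product `G ⊙ H`: one copy of `G` and, for each vertex `g` of `G`,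
a copy of `H` whose vertices are all joined to `g`. -/
def corona {V W : Type*} (G : SimpleGraph V) (H : SimpleGraph W) :
    SimpleGraph (V ⊕ V × W) :=
  SimpleGraph.fromRel (fun a b =>
    match a, b with
    | Sum.inl g, Sum.inl g' => G.Adj g g'
    | Sum.inl g, Sum.inr p => g = p.1
    | Sum.inr p, Sum.inr q => p.1 = q.1 ∧ H.Adj p.2 q.2
    | _, _ => False)

/-- The join `H + K₁`: a new vertex (`none`) adjacent to every vertex of `H`. -/
def joinK1 {W : Type*} (H : SimpleGraph W) : SimpleGraph (Option W) :=
  SimpleGraph.fromRel (fun a b =>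
    a = none ∨ ∃ w w', a = some w ∧ b = some w' ∧ H.Adj w w')

/-- The wheel `W_{1,n} = K₁ + Cₙ`, with central vertex `none`. -/
def wheel (n : ℕ) : SimpleGraph (Option (Fin n)) :=
  joinK1 (SimpleGraph.cycleGraph n)

/-- `A_{i,j}` is a gap of `X ⊆ V(Cₙ)`: `i, j ∈ X`, `i ≠ j`, and no vertex of
`{i+1, …, j-1}` (cyclically) lies in `X`. -/
def IsGap {n : ℕ} (X : Finset (Fin n)) (i j : Fin n) : Prop :=
  i ∈ X ∧ j ∈ X ∧ i ≠ j ∧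
    ∀ k : Fin n, 0 < (k - i).val → (k - i).val < (j - i).val → k ∉ X

/-- The number of vertices in the gap `A_{i,j} = {i+1, …, j-1}`. -/
def gapSize {n : ℕ} (i j : Fin n) : ℕ := (j - i).val - 1

/-- The edge cover number `β'(G)`: the least number of edges of `G` covering all
vertices. -/
noncomputable def edgeCoverNum {V : Type*} [Fintype V] (G : SimpleGraph V) : ℕ :=
  sInf {n | ∃ F : Finset (Sym2 V), F.card = n ∧ ↑F ⊆ G.edgeSet ∧ ∀ v : V, ∃ e ∈ F, v ∈ e}

set_option linter.unusedSectionVars false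
set_option linter.style.haveILetI false
section Helpers
variable {V : Type*} [Fintype V] [DecidableEq V] {T : SimpleGraph V} [DecidableRel T.Adj]

lemma tr_parent_unique (hT : T.IsTree) {u y z z' : V} (h1 : T.Adj z y) (h2 : T.Adj z' y)
    (d1 : T.dist u y = T.dist u z + 1) (d2 : T.dist u y = T.dist u z' + 1) : z = z' := by
  obtain ⟨p, hp⟩ := hT.connected.exists_walk_length_eq_dist u z
  obtain ⟨q, hq⟩ := hT.connected.exists_walk_length_eq_dist u z'
  have hp' : (p.concat h1).IsPath :=
    SimpleGraph.Walk.isPath_of_length_eq_dist _ (by rw [SimpleGraph.Walk.length_concat]; omega)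
  have hq' : (q.concat h2).IsPath :=
    SimpleGraph.Walk.isPath_of_length_eq_dist _ (by rw [SimpleGraph.Walk.length_concat]; omega)
  have := (hT.existsUnique_path u y).unique hp' hq'
  have h3 := congrArg SimpleGraph.Walk.penultimate this
  simpa using h3

lemma tr_parent_exists (hT : T.IsTree) {u y : V} (h : u ≠ y) :
    ∃ z, T.Adj z y ∧ T.dist u y = T.dist u z + 1 := by
  obtain ⟨p, hp⟩ := hT.connected.exists_walk_length_eq_dist y u
  cases p with
  | nil => exact absurd rfl h
  | @cons _ z _ hyz p =>
    refine ⟨z, hyz.symm, ?_⟩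
    have h1 := SimpleGraph.dist_le p
    have h2 := hT.dist_eq_dist_add_one_of_adj u hyz
    simp only [SimpleGraph.Walk.length_cons] at hp
    rw [SimpleGraph.dist_comm (u := u) (v := y), SimpleGraph.dist_comm (u := u) (v := z)] at *
    omega

lemma tr_leaf_nbr {l p q : V} (h : T.degree l = 1) (h1 : T.Adj l p) (h2 : T.Adj l q) : p = q :=
  (SimpleGraph.degree_eq_one_iff_existsUnique_adj.mp h).unique h1 h2

lemma tr_two_nbr {l p q : V} (hpq : p ≠ q) (h1 : T.Adj l p) (h2 : T.Adj l q) :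
    2 ≤ T.degree l := by
  rw [← SimpleGraph.card_neighborFinset_eq_degree, ← Finset.card_pair hpq]
  apply Finset.card_le_card
  intro x; simp; rintro (rfl | rfl) <;> assumption

lemma tr_three_nbr {l p q r : V} (hpq : p ≠ q) (hpr : p ≠ r) (hqr : q ≠ r)
    (h1 : T.Adj l p) (h2 : T.Adj l q) (h3 : T.Adj l r) :
    3 ≤ T.degree l := by
  rw [← SimpleGraph.card_neighborFinset_eq_degree,
    ← Finset.card_eq_three.mpr ⟨p, q, r, hpq, hpr, hqr, rfl⟩]
  apply Finset.card_le_card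
  intro x; simp; rintro (rfl | rfl | rfl) <;> assumption

lemma tr_avoid_two {c : V} (h : 3 ≤ T.degree c) (a b : V) :
    ∃ w, T.Adj c w ∧ w ≠ a ∧ w ≠ b := by
  have : ({a, b} : Finset V).card < (T.neighborFinset c).card := by
    rw [SimpleGraph.card_neighborFinset_eq_degree]
    exact lt_of_le_of_lt Finset.card_le_two (by omega)
  obtain ⟨w, hw, hw'⟩ := Finset.exists_mem_notMem_of_card_lt_card this
  simp at hw hw'
  exact ⟨w, hw, hw'.1, hw'.2⟩

lemma tr_avoid_one {c : V} (h : 2 ≤ T.degree c) (a : V) :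
    ∃ w, T.Adj c w ∧ w ≠ a := by
  have : ({a} : Finset V).card < (T.neighborFinset c).card := by
    rw [SimpleGraph.card_neighborFinset_eq_degree, Finset.card_singleton]; omega
  obtain ⟨w, hw, hw'⟩ := Finset.exists_mem_notMem_of_card_lt_card this
  simp at hw hw'
  exact ⟨w, hw, hw'⟩

lemma tr_deg_pos (hT : T.IsTree) (hn : 4 ≤ Fintype.card V) (v : V) : 1 ≤ T.degree v := by
  haveI : Nontrivial V := Fintype.one_lt_card_iff_nontrivial.mp (by omega)
  obtain ⟨u, hu⟩ := exists_ne v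
  obtain ⟨z, hz, -⟩ := tr_parent_exists hT hu
  exact (T.degree_pos_iff_exists_adj v).mpr ⟨z, hz.symm⟩

lemma tr_leaf_dist (hT : T.IsTree) {u l p : V} (h : T.degree l = 1) (h1 : T.Adj l p)
    (hu : u ≠ l) : T.dist u l = T.dist u p + 1 := by
  obtain ⟨z, hz, hd⟩ := tr_parent_exists hT hu
  rw [tr_leaf_nbr h h1 hz.symm]; exact hd

/-- A leaf beyond `v` as seen from `u`. -/
lemma tr_leaf_beyond (hT : T.IsTree) (hn : 4 ≤ Fintype.card V) {u v : V} (huv : u ≠ v) :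
    ∃ y, T.degree y = 1 ∧ T.dist u y = T.dist u v + T.dist v y := by
  obtain ⟨y, hy, hmax⟩ := Finset.exists_max_image
    (Finset.univ.filter fun y => T.dist u y = T.dist u v + T.dist v y) (fun y => T.dist u y)
    ⟨v, by simp⟩
  simp only [Finset.mem_filter, Finset.mem_univ, true_and] at hy hmax
  refine ⟨y, ?_, hy⟩
  by_contra hdeg
  have h1 := tr_deg_pos hT hn y
  have hpos := hT.connected.pos_dist_of_ne huv
  have huy : u ≠ y := by rintro rfl; simp at hy; omega
  obtain ⟨p, hp, hpd⟩ := tr_parent_exists hT huy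
  obtain ⟨z, hz, hzp⟩ := tr_avoid_one (T := T) (c := y) (by omega) p
  have hzd : T.dist u z = T.dist u y + 1 := by
    rcases hT.dist_eq_dist_add_one_of_adj u hz with h | h
    · exact absurd (tr_parent_unique hT hz.symm hp h hpd) hzp
    · exact h
  have h2 : T.dist v z ≤ T.dist v y + T.dist y z := hT.connected.dist_triangle
  have h3 : T.dist u z ≤ T.dist u v + T.dist v z := hT.connected.dist_triangle
  rw [SimpleGraph.dist_eq_one_iff_adj.mpr hz] at h2
  have := hmax z (by omega)
  omega

lemma tr_step (hT : T.IsTree) (hn : 4 ≤ Fintype.card V) {u c a : V} (hc : 3 ≤ T.degree c)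
    (ha : T.degree a = 1) (hac : T.Adj a c) (hua : u ≠ a) :
    ∃ y, T.degree y = 1 ∧ y ≠ a ∧ T.dist u y = T.dist u c + T.dist c y ∧
      T.dist u c + 1 ≤ T.dist u y := by
  have hda := tr_leaf_dist hT ha hac hua
  obtain ⟨w, hcw, hwa, hdw⟩ : ∃ w, T.Adj c w ∧ w ≠ a ∧ T.dist u w = T.dist u c + 1 := by
    by_cases huc : u = c
    · subst huc
      obtain ⟨w, h1, h2, -⟩ := tr_avoid_two hc a a
      exact ⟨w, h1, h2, by rw [SimpleGraph.dist_eq_one_iff_adj.mpr h1]; simp⟩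
    · obtain ⟨p, hp, hpd⟩ := tr_parent_exists hT huc
      obtain ⟨w, h1, h2, h3⟩ := tr_avoid_two hc a p
      refine ⟨w, h1, h2, ?_⟩
      rcases hT.dist_eq_dist_add_one_of_adj u h1 with h | h
      · exact absurd (tr_parent_unique hT h1.symm hp h hpd) h3
      · exact h
  have huw : u ≠ w := by rintro rfl; simp at hdw
  obtain ⟨y, hy, hyd⟩ := tr_leaf_beyond hT hn huw
  refine ⟨y, hy, ?_, ?_, by omega⟩
  · rintro rfl
    have : T.dist w y = 0 := by omega
    exact hwa (hT.connected.dist_eq_zero_iff.mp this)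
  · have h2 : T.dist c y ≤ T.dist c w + T.dist w y := hT.connected.dist_triangle
    have h3 : T.dist u y ≤ T.dist u c + T.dist c y := hT.connected.dist_triangle
    rw [SimpleGraph.dist_eq_one_iff_adj.mpr hcw] at h2
    omega

lemma tr_trans (hT : T.IsTree) {u v c y : V} (h1 : T.dist u c = T.dist u v + T.dist v c)
    (h2 : T.dist u y = T.dist u c + T.dist c y) : T.dist u y = T.dist u v + T.dist v y := by
  have h3 : T.dist u y ≤ T.dist u v + T.dist v y := hT.connected.dist_triangle
  have h4 : T.dist v y ≤ T.dist v c + T.dist c y := hT.connected.dist_triangle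
  omega

lemma tr_beyond_aux (hT : T.IsTree) (hn : 4 ≤ Fintype.card V) {c d a b u v : V}
    (hc : 3 ≤ T.degree c) (hd : 3 ≤ T.degree d) (hcd : c ≠ d) (ha : T.degree a = 1)
    (hb : T.degree b = 1) (hac : T.Adj a c) (hbd : T.Adj b d) (huv : u ≠ v) (hva : v ≠ a)
    (hy : T.dist u a = T.dist u v + T.dist v a) :
    ∃ y, T.degree y = 1 ∧ y ≠ a ∧ y ≠ b ∧ T.dist u y = T.dist u v + T.dist v y := by
  have hpos := hT.connected.pos_dist_of_ne huv
  have hua : u ≠ a := by rintro rfl; simp at hy; omega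
  have e1 := tr_leaf_dist hT ha hac hua
  have e2 := tr_leaf_dist hT ha hac hva
  have e3 : T.dist u c = T.dist u v + T.dist v c := by omega
  obtain ⟨y, y1, y2, y3, y4⟩ := tr_step hT hn hc ha hac hua
  by_cases hyb : y = b
  · subst hyb
    have huy : u ≠ y := by rintro rfl; simp at y4
    have hcy : c ≠ y := by rintro rfl; omega
    have f1 := tr_leaf_dist hT hb hbd huy
    have f2 := tr_leaf_dist hT hb hbd hcy
    have f3 : T.dist u d = T.dist u c + T.dist c d := by omega
    have f4 := hT.connected.pos_dist_of_ne hcd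
    obtain ⟨z, z1, z2, z3, z4⟩ := tr_step hT hn hd hb hbd huy
    refine ⟨z, z1, ?_, z2, tr_trans hT (tr_trans hT e3 f3) z3⟩
    rintro rfl
    omega
  · exact ⟨y, y1, y2, hyb, tr_trans hT e3 y3⟩

lemma tr_beyond (hT : T.IsTree) (hn : 4 ≤ Fintype.card V) {c d a b u v : V}
    (hc : 3 ≤ T.degree c) (hd : 3 ≤ T.degree d) (hcd : c ≠ d) (ha : T.degree a = 1)
    (hb : T.degree b = 1) (hac : T.Adj a c) (hbd : T.Adj b d) (huv : u ≠ v) (hva : v ≠ a)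
    (hvb : v ≠ b) :
    ∃ y, T.degree y = 1 ∧ y ≠ a ∧ y ≠ b ∧ T.dist u y ≠ T.dist v y := by
  have hpos := hT.connected.pos_dist_of_ne huv
  suffices ∃ y, T.degree y = 1 ∧ y ≠ a ∧ y ≠ b ∧ T.dist u y = T.dist u v + T.dist v y by
    obtain ⟨y, h1, h2, h3, h4⟩ := this
    exact ⟨y, h1, h2, h3, by omega⟩
  obtain ⟨y, hy, hyd⟩ := tr_leaf_beyond hT hn huv
  by_cases h1 : y = a
  · subst h1
    exact tr_beyond_aux hT hn hc hd hcd ha hb hac hbd huv hva hyd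
  by_cases h2 : y = b
  · subst h2
    obtain ⟨y, h1, h2, h3, h4⟩ :=
      tr_beyond_aux hT hn hd hc hcd.symm hb ha hbd hac huv hvb hyd
    exact ⟨y, h1, h3, h2, h4⟩
  exact ⟨y, hy, h1, h2, hyd⟩

/-- The leaves of `T`. -/
def trLeaves (T : SimpleGraph V) [DecidableRel T.Adj] : Finset V :=
  Finset.univ.filter fun y => T.degree y = 1

lemma tr_mem_leaves {y : V} : y ∈ trLeaves T ↔ T.degree y = 1 := by simp [trLeaves]

lemma tr_leaf_exists (hT : T.IsTree) (hn : 4 ≤ Fintype.card V) : ∃ a, T.degree a = 1 := by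
  haveI : Nontrivial V := Fintype.one_lt_card_iff_nontrivial.mp (by omega)
  exact hT.exists_vert_degree_one_of_nontrivial

lemma tr_nldim_le (X : Finset V) (h : IsNLResolving T X) : nldim T ≤ X.card :=
  Nat.sInf_le ⟨X, rfl, h⟩

/-- (A) `dim_nl ≤ ℓ - 1`. -/
lemma tr_nldim_le_one (hT : T.IsTree) (hn : 4 ≤ Fintype.card V) :
    nldim T + 1 ≤ (trLeaves T).card := by
  obtain ⟨a, ha⟩ := tr_leaf_exists hT hn
  have hmem : a ∈ trLeaves T := tr_mem_leaves.mpr ha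
  have hpos := Finset.card_pos.mpr ⟨a, hmem⟩
  have : nldim T ≤ ((trLeaves T).erase a).card := by
    apply tr_nldim_le
    intro u v huv _
    have hp := hT.connected.pos_dist_of_ne huv
    have hcm : T.dist v u = T.dist u v := SimpleGraph.dist_comm
    obtain ⟨y, hy, hyd⟩ := tr_leaf_beyond hT hn huv
    obtain ⟨z, hz, hzd⟩ := tr_leaf_beyond hT hn huv.symm
    by_cases hya : y = a
    · refine ⟨z, Finset.mem_erase.mpr ⟨?_, tr_mem_leaves.mpr hz⟩, by omega⟩
      rintro rfl
      subst hya
      omega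
    · exact ⟨y, Finset.mem_erase.mpr ⟨hya, tr_mem_leaves.mpr hy⟩, by omega⟩
  rw [Finset.card_erase_of_mem hmem] at this
  omega

/-- (C) `dim_nl ≤ ℓ - 2`. -/
lemma tr_nldim_le_two (hT : T.IsTree) (hn : 4 ≤ Fintype.card V) {c d a b : V}
    (hc : 3 ≤ T.degree c) (hd : 3 ≤ T.degree d) (hcd : c ≠ d) (ha : T.degree a = 1)
    (hb : T.degree b = 1) (hac : T.Adj a c) (hbd : T.Adj b d) :
    nldim T + 2 ≤ (trLeaves T).card := by
  have hab : a ≠ b := by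
    rintro rfl
    exact hcd (tr_leaf_nbr ha hac hbd)
  have hma : a ∈ trLeaves T := tr_mem_leaves.mpr ha
  have hmb : b ∈ (trLeaves T).erase a := Finset.mem_erase.mpr ⟨hab.symm, tr_mem_leaves.mpr hb⟩
  have key : ∀ u v : V, u ≠ v → v ≠ a → v ≠ b →
      ∃ y ∈ ((trLeaves T).erase a).erase b, T.dist u y ≠ T.dist v y := by
    intro u v huv hva hvb
    obtain ⟨y, h1, h2, h3, h4⟩ := tr_beyond hT hn hc hd hcd ha hb hac hbd huv hva hvb
    exact ⟨y, Finset.mem_erase.mpr ⟨h3, Finset.mem_erase.mpr ⟨h2, tr_mem_leaves.mpr h1⟩⟩, h4⟩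
  have hda : d ≠ a := by rintro rfl; omega
  have hdb : d ≠ b := by rintro rfl; omega
  have kab : ∃ y ∈ ((trLeaves T).erase a).erase b, T.dist a y ≠ T.dist b y := by
    obtain ⟨y, hy, hyd⟩ := key c d hcd hda hdb
    have hy' := hy
    simp only [Finset.mem_erase] at hy'
    refine ⟨y, hy, ?_⟩
    have e1 := tr_leaf_dist hT ha hac hy'.2.1
    have e2 := tr_leaf_dist hT hb hbd hy'.1
    rw [SimpleGraph.dist_comm (u := a), SimpleGraph.dist_comm (u := b), e1, e2,
      SimpleGraph.dist_comm (v := c), SimpleGraph.dist_comm (v := d)]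
    omega
  have : nldim T ≤ (((trLeaves T).erase a).erase b).card := by
    apply tr_nldim_le
    intro u v huv _
    by_cases hv : v ≠ a ∧ v ≠ b
    · exact key u v huv hv.1 hv.2
    by_cases hu : u ≠ a ∧ u ≠ b
    · obtain ⟨y, h1, h2⟩ := key v u huv.symm hu.1 hu.2
      exact ⟨y, h1, h2.symm⟩
    obtain ⟨y, h1, h2⟩ := kab
    refine ⟨y, h1, ?_⟩
    have hv' : v = a ∨ v = b := by tauto
    have hu' : u = a ∨ u = b := by tauto
    rcases hv' with rfl | rfl <;> rcases hu' with rfl | rfl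
    · exact absurd rfl huv
    · exact h2.symm
    · exact h2
    · exact absurd rfl huv
  have p1 := Finset.card_pos.mpr ⟨b, hmb⟩
  rw [Finset.card_erase_of_mem hmb] at this
  rw [Finset.card_erase_of_mem hma] at this p1
  omega

lemma tr_leaves_not_adj (hT : T.IsTree) (hbranch : ∃ v : V, 3 ≤ T.degree v) {x y : V}
    (hx : T.degree x = 1) (hy : T.degree y = 1) : ¬ T.Adj x y := by
  intro h
  obtain ⟨c, hc⟩ := hbranch
  have h1 := tr_leaf_dist hT (u := c) hx h (by rintro rfl; omega)
  have h2 := tr_leaf_dist hT (u := c) hy h.symm (by rintro rfl; omega)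
  omega

lemma tr_cover_inj (hT : T.IsTree) (hbranch : ∃ v : V, 3 ≤ T.degree v) {F : Finset (Sym2 V)}
    (hF : ↑F ⊆ T.edgeSet) (hcov : ∀ v : V, ∃ e ∈ F, v ∈ e) :
    ∃ g : V → Sym2 V, (∀ v, g v ∈ F ∧ v ∈ g v) ∧ Set.InjOn g (trLeaves T) := by
  choose g hg1 hg2 using hcov
  refine ⟨g, fun v => ⟨hg1 v, hg2 v⟩, ?_⟩
  intro x hx y hy hxy
  by_contra hne
  have hx' := tr_mem_leaves.mp hx
  have hy' := tr_mem_leaves.mp hy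
  have h1 := hg2 x
  have h2 := hg2 y
  rw [← hxy] at h2
  have h3 := (Sym2.mem_and_mem_iff hne).mp ⟨h1, h2⟩
  have h4 : g x ∈ T.edgeSet := hF (hg1 x)
  rw [h3] at h4
  exact tr_leaves_not_adj hT hbranch hx' hy' h4

lemma tr_cover_exists (hT : T.IsTree) (hn : 4 ≤ Fintype.card V) :
    ∃ F : Finset (Sym2 V), F.card = edgeCoverNum T ∧ ↑F ⊆ T.edgeSet ∧
      ∀ v : V, ∃ e ∈ F, v ∈ e := by
  have : edgeCoverNum T ∈ {n | ∃ F : Finset (Sym2 V), F.card = n ∧ ↑F ⊆ T.edgeSet ∧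
      ∀ v : V, ∃ e ∈ F, v ∈ e} := by
    apply Nat.sInf_mem
    refine ⟨_, T.edgeFinset, rfl, by simp, fun v => ?_⟩
    obtain ⟨w, hw⟩ := (T.degree_pos_iff_exists_adj v).mp (tr_deg_pos hT hn v)
    exact ⟨s(v, w), by simpa using hw, by simp⟩
  exact this

lemma tr_leaves_le (hT : T.IsTree) (hn : 4 ≤ Fintype.card V)
    (hbranch : ∃ v : V, 3 ≤ T.degree v) : (trLeaves T).card ≤ edgeCoverNum T := by
  obtain ⟨F, h1, h2, h3⟩ := tr_cover_exists hT hn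
  obtain ⟨g, hg, hinj⟩ := tr_cover_inj hT hbranch h2 h3
  rw [← h1]
  exact Finset.card_le_card_of_injOn g (fun v _ => (hg v).1) hinj

/-- (B) -/
lemma tr_all_near (hT : T.IsTree) (hn : 4 ≤ Fintype.card V)
    (hbranch : ∃ v : V, 3 ≤ T.degree v) (hle : edgeCoverNum T ≤ (trLeaves T).card) (v : V) :
    T.degree v = 1 ∨ ∃ l, T.degree l = 1 ∧ T.Adj l v := by
  obtain ⟨F, h1, h2, h3⟩ := tr_cover_exists hT hn
  obtain ⟨g, hg, hinj⟩ := tr_cover_inj hT hbranch h2 h3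
  obtain ⟨e, he, hve⟩ := h3 v
  obtain ⟨l, hl, rfl⟩ := Finset.surj_on_of_inj_on_of_card_le (s := trLeaves T) (t := F)
    (fun a _ => g a) (fun a _ => (hg a).1) (fun a b ha hb hab => hinj ha hb hab)
    (by omega) e he
  have hl' := tr_mem_leaves.mp hl
  by_cases hlv : l = v
  · left; rw [← hlv]; exact hl'
  · right
    refine ⟨l, hl', ?_⟩
    have h5 := (Sym2.mem_and_mem_iff hlv).mp ⟨(hg l).2, hve⟩
    have h4 : g l ∈ T.edgeSet := h2 he
    rw [h5] at h4
    exact h4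

lemma tr_cover_le (hT : T.IsTree) (hn : 4 ≤ Fintype.card V)
    (h : ∀ v : V, T.degree v = 1 ∨ ∃ l, T.degree l = 1 ∧ T.Adj l v) :
    edgeCoverNum T ≤ (trLeaves T).card := by
  have : ∀ v : V, ∃ w, T.Adj v w := fun v =>
    (T.degree_pos_iff_exists_adj v).mp (tr_deg_pos hT hn v)
  choose f hf using this
  refine le_trans (Nat.sInf_le ⟨(trLeaves T).image fun l => s(l, f l), rfl, ?_, ?_⟩)
    Finset.card_image_le
  · intro e he
    simp only [Finset.coe_image, Set.mem_image] at he
    obtain ⟨l, -, rfl⟩ := he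
    exact hf l
  · intro v
    rcases h v with h | ⟨l, hl, hlv⟩
    · exact ⟨s(v, f v), Finset.mem_image_of_mem _ (tr_mem_leaves.mpr h), by simp⟩
    · refine ⟨s(l, f l), Finset.mem_image_of_mem _ (tr_mem_leaves.mpr hl), ?_⟩
      rw [tr_leaf_nbr hl hlv (hf l)]; simp

lemma tr_forward (hT : T.IsTree) (hn : 4 ≤ Fintype.card V)
    (hbranch : ∃ v : V, 3 ≤ T.degree v) (h : nldim T = edgeCoverNum T - 1) :
    ∃ c : V, 3 ≤ T.degree c ∧ (∀ v : V, T.dist c v ≤ 2) ∧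
      (∀ v : V, v ≠ c → T.degree v ≤ 2) ∧ (∃ u : V, T.Adj c u ∧ T.degree u = 1) := by
  have h1 := tr_nldim_le_one hT hn
  have hle : edgeCoverNum T ≤ (trLeaves T).card := by omega
  have hge := tr_leaves_le hT hn hbranch
  have near := tr_all_near hT hn hbranch hle
  obtain ⟨c, hc⟩ := hbranch
  obtain ⟨a, ha, hac⟩ := (near c).resolve_left (by omega)
  have hdeg : ∀ v : V, v ≠ c → T.degree v ≤ 2 := by
    intro d hdc
    by_contra hd
    obtain ⟨b, hb, hbd⟩ := (near d).resolve_left (by omega)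
    have := tr_nldim_le_two hT hn hc (by omega) hdc.symm ha hb hac hbd
    omega
  refine ⟨c, hc, ?_, hdeg, a, hac.symm, ha⟩
  have no3 : ∀ v, T.dist c v ≠ 3 := by
    intro z hz
    have hcz : c ≠ z := by rintro rfl; simp at hz
    obtain ⟨w, hwz, hw⟩ := tr_parent_exists hT hcz
    have hcw : c ≠ w := by rintro rfl; rw [SimpleGraph.dist_self] at hw; omega
    obtain ⟨p, hpw, hp⟩ := tr_parent_exists hT hcw
    have hcp : T.Adj c p := SimpleGraph.dist_eq_one_iff_adj.mp (by omega)
    have hpz : p ≠ z := by rintro rfl; omega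
    have hw2 := tr_two_nbr hpz hpw.symm hwz
    have hp2 := tr_two_nbr hcw hcp.symm hpw
    obtain ⟨l, hl, hlp⟩ := (near p).resolve_left (by omega)
    have := tr_three_nbr (l := p) (p := c) (q := w) (r := l) hcw (by rintro rfl; omega)
      (by rintro rfl; omega) hcp.symm hpw hlp.symm
    have := hdeg p hcp.ne'
    omega
  have : ∀ n, ∀ v, T.dist c v = n + 3 → False := by
    intro n
    induction n with
    | zero => intro v hv; exact no3 v hv
    | succ n ih =>
      intro v hv
      have hcv : c ≠ v := by rintro rfl; simp at hv
      obtain ⟨w, -, hw⟩ := tr_parent_exists hT hcv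
      exact ih w (by omega)
  intro v
  by_contra hv
  exact this (T.dist c v - 3) v (by omega)

lemma tr_backward (hT : T.IsTree) (hn : 4 ≤ Fintype.card V) {c u : V}
    (hc : 3 ≤ T.degree c) (h2 : ∀ v : V, T.dist c v ≤ 2)
    (hdeg : ∀ v : V, v ≠ c → T.degree v ≤ 2) (hcu : T.Adj c u) (hu : T.degree u = 1) :
    nldim T = edgeCoverNum T - 1 := by
  have hA := tr_nldim_le_one hT hn
  have hge := tr_leaves_le hT hn ⟨c, hc⟩
  have far : ∀ v, T.dist c v = 2 → T.degree v = 1 := by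
    intro v hv
    by_contra hd
    have := tr_deg_pos hT hn v
    have hcv : c ≠ v := by rintro rfl; simp at hv
    obtain ⟨p, hp, hpd⟩ := tr_parent_exists hT hcv
    obtain ⟨z, hz, hzp⟩ := tr_avoid_one (T := T) (c := v) (by omega) p
    rcases hT.dist_eq_dist_add_one_of_adj c hz with h | h
    · exact hzp (tr_parent_unique hT hz.symm hp h hpd)
    · have := h2 z; omega
  have hle : edgeCoverNum T ≤ (trLeaves T).card := by
    apply tr_cover_le hT hn
    intro v
    by_cases hvc : v = c
    · subst hvc; exact Or.inr ⟨u, hu, hcu.symm⟩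
    by_cases hv : T.degree v = 1
    · exact Or.inl hv
    right
    have h3 := h2 v
    have h4 := hT.connected.pos_dist_of_ne (Ne.symm hvc)
    have h5 : T.dist c v ≠ 2 := fun h => hv (far v h)
    have hd1 : T.dist c v = 1 := by omega
    have hcv := SimpleGraph.dist_eq_one_iff_adj.mp hd1
    have := tr_deg_pos hT hn v
    obtain ⟨z, hz, hzc⟩ := tr_avoid_one (T := T) (c := v) (by omega) c
    refine ⟨z, far z ?_, hz.symm⟩
    rcases hT.dist_eq_dist_add_one_of_adj c hz with h | h
    · have h0 : T.dist c z = 0 := by omega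
      exact absurd (hT.connected.dist_eq_zero_iff.mp h0).symm hzc
    · omega
  -- the branch map
  have hbr : ∀ x : V, ∃ w, x ≠ c → T.Adj w c ∧ T.dist x c = T.dist x w + 1 := by
    intro x
    by_cases hx : x = c
    · exact ⟨x, fun h => absurd hx h⟩
    · obtain ⟨w, hw⟩ := tr_parent_exists hT hx
      exact ⟨w, fun _ => hw⟩
  choose f hf using hbr
  have hl : (trLeaves T).card ≤ T.degree c := by
    rw [← SimpleGraph.card_neighborFinset_eq_degree]
    have hlc : ∀ x, T.degree x = 1 → x ≠ c := by rintro x hx rfl; omega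
    have hcase : ∀ x, T.degree x = 1 → x = f x ∨ T.Adj x (f x) := by
      intro x hx
      have h3 := (hf x (hlc x hx)).2
      have h4 := h2 x
      rw [SimpleGraph.dist_comm] at h4
      have h5 : T.dist x (f x) = 0 ∨ T.dist x (f x) = 1 := by omega
      rcases h5 with h5 | h5
      · exact Or.inl (hT.connected.dist_eq_zero_iff.mp h5)
      · exact Or.inr (SimpleGraph.dist_eq_one_iff_adj.mp h5)
    apply Finset.card_le_card_of_injOn f
    · intro x hx
      have := (hf x (hlc x (tr_mem_leaves.mp hx))).1
      simpa using this.symm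
    · intro x hx y hy hxy
      have hx := tr_mem_leaves.mp hx
      have hy := tr_mem_leaves.mp hy
      by_contra hne
      have ax := (hf x (hlc x hx)).1
      have cx := hcase x hx
      have cy := hcase y hy
      rw [← hxy] at cy
      have d2 := hdeg (f x) ax.ne
      rcases cx with cx | cx <;> rcases cy with cy | cy
      · exact hne (cx.trans cy.symm)
      · have := tr_two_nbr (hlc y hy) cy.symm ax
        rw [← cx] at this; omega
      · have := tr_two_nbr (hlc x hx) cx.symm ax
        rw [← cy] at this; omega
      · have := tr_three_nbr hne (hlc x hx) (hlc y hy) cx.symm cy.symm ax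
        omega
  have hlow : ∀ X : Finset V, IsNLResolving T X → T.degree c ≤ X.card + 1 := by
    intro X hX
    by_contra hlt
    have hcard : 1 < (T.neighborFinset c \ X.image f).card := by
      have e1 := Finset.le_card_sdiff (X.image f) (T.neighborFinset c)
      have e2 : (X.image f).card ≤ X.card := Finset.card_image_le
      rw [SimpleGraph.card_neighborFinset_eq_degree] at e1
      omega
    obtain ⟨w, hw, w', hw', hne⟩ := Finset.one_lt_card.mp hcard
    simp only [Finset.mem_sdiff, SimpleGraph.mem_neighborFinset, Finset.mem_image, not_exists,
      not_and] at hw hw'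
    have hd : ∀ w, T.Adj c w → (∀ x ∈ X, f x ≠ w) → ∀ x ∈ X,
        T.dist w x = T.dist c x + 1 := by
      intro w hcw hfw x hx
      rw [SimpleGraph.dist_comm, SimpleGraph.dist_comm (u := c)]
      rcases hT.dist_eq_dist_add_one_of_adj x hcw with h | h
      · have hxc : x ≠ c := by rintro rfl; simp at h
        obtain ⟨g1, g2⟩ := hf x hxc
        exact absurd (tr_parent_unique hT g1 hcw.symm g2 h) (hfw x hx)
      · exact h
    have hnadj : ¬ T.Adj w w' := by
      intro h
      have e := hT.dist_ne_of_adj c h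
      rw [SimpleGraph.dist_eq_one_iff_adj.mpr hw.1, SimpleGraph.dist_eq_one_iff_adj.mpr hw'.1] at e
      exact e rfl
    obtain ⟨x, hx, hxd⟩ := hX w w' hne hnadj
    exact hxd ((hd w hw.1 hw.2 x hx).trans (hd w' hw'.1 hw'.2 x hx).symm)
  have hmem : ∃ X : Finset V, X.card = nldim T ∧ IsNLResolving T X := by
    have : nldim T ∈ {n | ∃ X : Finset V, X.card = n ∧ IsNLResolving T X} := by
      apply Nat.sInf_mem
      refine ⟨_, Finset.univ, rfl, fun u v huv _ => ⟨u, Finset.mem_univ _, ?_⟩⟩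
      have := hT.connected.pos_dist_of_ne huv.symm
      simp; omega
    exact this
  obtain ⟨X, hXc, hX⟩ := hmem
  have := hlow X hX
  omega

end Helpers

/-- For a tree `T` which is not a path (it has a vertex of
degree at least `3`) with `n(T) ≥ 4`, `dim_nl(T) = β'(T) − 1` iff `T` is
obtained from a star `K_{1,n}` (`n ≥ 3`) by subdividing all but one of its
edges at most once each — i.e. `T` is a spider with center `c` of degree
`≥ 3`, all legs of length at most `2`, and at least one leg of length `1`. -/
theorem stmt_18 {V : Type*} [Fintype V] [DecidableEq V] (T : SimpleGraph V)
    [DecidableRel T.Adj] (hT : T.IsTree)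
    (hbranch : ∃ v : V, 3 ≤ T.degree v) (hn : 4 ≤ Fintype.card V) :
    nldim T = edgeCoverNum T - 1 ↔
      ∃ c : V, 3 ≤ T.degree c ∧
        (∀ v : V, T.dist c v ≤ 2) ∧
        (∀ v : V, v ≠ c → T.degree v ≤ 2) ∧
        (∃ u : V, T.Adj c u ∧ T.degree u = 1) := by
  constructor
  · exact tr_forward hT hn hbranch
  · rintro ⟨c, h1, h2, h3, u, h4, h5⟩
    exact tr_backward hT hn h1 h2 h3 h4 h5
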